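/- For all nonnegative integers l, m, n, the q-Dixon identity holds: [l+m+n]! [2l]! [2m]! [2n]! / ([l]! [m]! [n]! [l+m]! [m+n]! [n+l]!) = sum over integers k of (-1)^k q^{k(3k-1)/2} qbinom(2l, l+k) qbinom(2m, m+k) qbinom(2n, n+k), where the sum runs over -min(l,m,n) <= k <= min(l,m,n). -/

import Mathlib

open Finset

/-- The `q`-factorial `[n]! = [1][2]⋯[n]`, as a rational function in `q`. -/
noncomputable def qFact (n : ℕ) : RatFunc ℚ :=
  ∏ i ∈ range n, ∑ j ∈ range (i + 1), RatFunc.X ^ j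

/-- The `q`-binomial coefficient `[a]!/([b]![a-b]!)`, equal to `0` when `b > a`. -/
noncomputable def qBinom (a b : ℕ) : RatFunc ℚ :=
  if b ≤ a then qFact a / (qFact b * qFact (a - b)) else 0

theorem ratFunc_X_pow_ne_one {n : ℕ} (hn : n ≠ 0) : (RatFunc.X : RatFunc ℚ) ^ n ≠ 1 := by
  intro h
  rw [← RatFunc.algebraMap_X, ← map_pow, ← map_one (algebraMap (Polynomial ℚ) (RatFunc ℚ))] at h
  have h' := congrArg Polynomial.natDegree (RatFunc.algebraMap_injective ℚ h)
  simp [hn] at h'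

theorem one_sub_ratFunc_X_ne_zero : (1 - RatFunc.X : RatFunc ℚ) ≠ 0 := by
  have h := ratFunc_X_pow_ne_one one_ne_zero
  rw [pow_one] at h
  exact sub_ne_zero.mpr h.symm

/-- The `q`-integer `[j] = (1 - q ^ j) / (1 - q)`. -/
noncomputable def qInt (j : ℤ) : RatFunc ℚ :=
  (1 - RatFunc.X ^ j) / (1 - RatFunc.X)

theorem qInt_zero : qInt 0 = 0 := by simp [qInt]

theorem qInt_natCast_ne_zero {n : ℕ} (hn : n ≠ 0) : qInt n ≠ 0 := by
  rw [qInt, zpow_natCast]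
  exact div_ne_zero (sub_ne_zero.mpr (ratFunc_X_pow_ne_one hn).symm) one_sub_ratFunc_X_ne_zero

theorem qFact_zero : qFact 0 = 1 := by simp [qFact]

theorem qFact_succ (n : ℕ) : qFact (n + 1) = qFact n * qInt (n + 1 : ℕ) := by
  rw [qFact, prod_range_succ, ← qFact, qInt, zpow_natCast]
  congr 1
  rw [eq_div_iff one_sub_ratFunc_X_ne_zero]
  exact geom_sum_mul_neg _ _

theorem qFact_ne_zero (n : ℕ) : qFact n ≠ 0 := by
  induction n with
  | zero => simp [qFact_zero]
  | succ n ih =>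
    rw [qFact_succ]
    exact mul_ne_zero ih (qInt_natCast_ne_zero n.succ_ne_zero)

/-- The reciprocal `1 / [j]!`, extended by `0` to negative `j`. -/
noncomputable def qInvFact (j : ℤ) : RatFunc ℚ :=
  if 0 ≤ j then (qFact j.toNat)⁻¹ else 0

theorem qInvFact_of_neg {j : ℤ} (hj : j < 0) : qInvFact j = 0 := by
  simp [qInvFact, hj]

theorem qInvFact_natCast (n : ℕ) : qInvFact n = (qFact n)⁻¹ := by
  simp [qInvFact]

theorem qInvFact_mul_qInt (j : ℤ) : qInvFact j * qInt j = qInvFact (j - 1) := by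
  rcases lt_trichotomy j 0 with hj | rfl | hj
  · rw [qInvFact_of_neg hj, qInvFact_of_neg (by omega), zero_mul]
  · rw [qInt_zero, mul_zero, qInvFact_of_neg (by norm_num)]
  · obtain ⟨n, rfl⟩ : ∃ n : ℕ, j = (n + 1 : ℕ) := ⟨(j - 1).toNat, by omega⟩
    have hj' : ((n + 1 : ℕ) : ℤ) - 1 = n := by push_cast; ring
    rw [hj', qInvFact_natCast, qInvFact_natCast, qFact_succ, mul_inv, mul_assoc,
      inv_mul_cancel₀ (qInt_natCast_ne_zero n.succ_ne_zero), mul_one]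

/-- The product `1 / ([n + k]! [n - k]!)`. -/
noncomputable def qInvFactPair (n k : ℤ) : RatFunc ℚ :=
  qInvFact (n + k) * qInvFact (n - k)

theorem qInvFactPair_neg (n k : ℤ) : qInvFactPair n (-k) = qInvFactPair n k := by
  rw [qInvFactPair, qInvFactPair, sub_neg_eq_add, ← sub_eq_add_neg, mul_comm]

theorem qInvFactPair_eq_zero {n k : ℤ} (h : n < |k|) : qInvFactPair n k = 0 := by
  rcases lt_abs.mp h with h | h
  · rw [qInvFactPair, qInvFact_of_neg (j := n - k) (by omega), mul_zero]
  · rw [qInvFactPair, qInvFact_of_neg (j := n + k) (by omega), zero_mul]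

theorem qInvFactPair_sub_one (n k : ℤ) :
    qInvFactPair (n - 1) k = qInvFactPair n k * qInt (n + k) * qInt (n - k) := by
  rw [qInvFactPair, qInvFactPair, show n - 1 + k = n + k - 1 by ring,
    show n - 1 - k = n - k - 1 by ring, ← qInvFact_mul_qInt, ← qInvFact_mul_qInt]
  ring

theorem qInvFactPair_succ_mul (n k : ℤ) :
    qInvFactPair n (k + 1) * qInt (n + (k + 1)) = qInvFactPair n k * qInt (n - k) := by
  have h₁ := qInvFact_mul_qInt (n + (k + 1))
  have h₂ := qInvFact_mul_qInt (n - k)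
  rw [show n + (k + 1) - 1 = n + k by ring] at h₁
  rw [show n - k - 1 = n - (k + 1) by ring] at h₂
  rw [qInvFactPair, qInvFactPair, ← h₁, ← h₂]
  ring

theorem qBinom_two_mul (n : ℕ) {k : ℤ} (hk : -n ≤ k) :
    qBinom (2 * n) (n + k).toNat = qFact (2 * n) * qInvFactPair n k := by
  by_cases h : k ≤ n
  · rw [qBinom, if_pos (by omega), qInvFactPair, qInvFact, qInvFact, if_pos (by omega),
      if_pos (by omega), show 2 * n - (n + k).toNat = (n - k).toNat by omega, div_eq_mul_inv,
      mul_inv]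
  · rw [qBinom, if_neg (by omega), qInvFactPair_eq_zero (lt_abs.mpr (Or.inl (by omega))),
      mul_zero]

theorem even_mul_three_mul_sub_one (k : ℤ) : Even (k * (3 * k - 1)) := by
  rw [Int.even_mul, Int.even_sub, Int.even_mul]
  grind

theorem pentagonalExponent_succ (k : ℤ) :
    (k + 1) * (3 * (k + 1) - 1) / 2 = k * (3 * k - 1) / 2 + (3 * k + 1) := by
  obtain ⟨a, ha⟩ := even_mul_three_mul_sub_one k
  have : (k + 1) * (3 * (k + 1) - 1) = k * (3 * k - 1) + 2 * (3 * k + 1) := by ring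
  omega

theorem pentagonalExponent_neg (k : ℤ) : -k * (3 * -k - 1) / 2 = k * (3 * k - 1) / 2 + k := by
  obtain ⟨a, ha⟩ := even_mul_three_mul_sub_one k
  have : -k * (3 * -k - 1) = k * (3 * k - 1) + 2 * k := by ring
  omega

/-- The signed power `(-1) ^ k q ^ (k (3 k - 1) / 2)`. -/
noncomputable def pentagonalWeight (k : ℤ) : RatFunc ℚ :=
  (-1) ^ k * RatFunc.X ^ (k * (3 * k - 1) / 2)

theorem pentagonalWeight_succ (k : ℤ) :
    pentagonalWeight (k + 1) = -(pentagonalWeight k * RatFunc.X ^ (3 * k + 1)) := by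
  rw [pentagonalWeight, pentagonalWeight, pentagonalExponent_succ,
    zpow_add₀ (RatFunc.X_ne_zero (K := ℚ)),
    zpow_add_one₀ (by norm_num)]
  ring

theorem pentagonalWeight_neg (k : ℤ) :
    pentagonalWeight (-k) = pentagonalWeight k * RatFunc.X ^ k := by
  rw [pentagonalWeight, pentagonalWeight, pentagonalExponent_neg,
    zpow_add₀ (RatFunc.X_ne_zero (K := ℚ)), zpow_neg,
    ← inv_zpow, show ((-1 : RatFunc ℚ)⁻¹) = -1 by norm_num]
  ring

/-- The summand of the `q`-Dixon identity, divided by `[2l]! [2m]! [2n]!`. -/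
noncomputable def dixonTerm (l m n k : ℤ) : RatFunc ℚ :=
  pentagonalWeight k * qInvFactPair l k * qInvFactPair m k * qInvFactPair n k

theorem dixonTerm_neg (l m n k : ℤ) :
    dixonTerm l m n (-k) = dixonTerm l m n k * RatFunc.X ^ k := by
  simp only [dixonTerm, qInvFactPair_neg, pentagonalWeight_neg]
  ring

theorem dixonTerm_sub_one (l m n k : ℤ) :
    dixonTerm l m (n - 1) k = dixonTerm l m n k * qInt (n + k) * qInt (n - k) := by
  rw [dixonTerm, dixonTerm, qInvFactPair_sub_one]
  ring

/-- The Wilf–Zeilberger mate of the symmetrized term `(1 + q ^ k) * dixonTerm l m n k`. -/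
noncomputable def dixonMate (l m n k : ℤ) : RatFunc ℚ :=
  -(RatFunc.X ^ (n - k) * dixonTerm l m n k * qInt (l + k) * qInt (m + k) * qInt (n + k))

theorem dixonMate_succ (l m n k : ℤ) :
    dixonMate l m n (k + 1) =
      RatFunc.X ^ (n + 2 * k) * dixonTerm l m n k * qInt (l - k) * qInt (m - k) *
        qInt (n - k) := by
  have hX : (RatFunc.X : RatFunc ℚ) ^ (n + 2 * k) =
      RatFunc.X ^ (n - (k + 1)) * RatFunc.X ^ (3 * k + 1) := by
    rw [← zpow_add₀ RatFunc.X_ne_zero]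
    congr 1
    ring
  rw [dixonMate, dixonTerm, dixonTerm, pentagonalWeight_succ, hX]
  have hpairs := congrArg₂ (· * ·)
    (congrArg₂ (· * ·) (qInvFactPair_succ_mul l k) (qInvFactPair_succ_mul m k))
    (qInvFactPair_succ_mul n k)
  linear_combination
    RatFunc.X ^ (n - (k + 1)) * RatFunc.X ^ (3 * k + 1) * pentagonalWeight k * hpairs

theorem qInt_dixon_identity (l m n k : ℤ) :
    (1 + RatFunc.X ^ k) * (qInt n * qInt (m + n) * qInt (n + l) -
        qInt (l + m + n) * (qInt (n + k) * qInt (n - k))) =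
      RatFunc.X ^ (n + 2 * k) * (qInt (l - k) * qInt (m - k) * qInt (n - k)) +
        RatFunc.X ^ (n - k) * (qInt (l + k) * qInt (m + k) * qInt (n + k)) := by
  have h := one_sub_ratFunc_X_ne_zero
  have hX : (RatFunc.X : RatFunc ℚ) ≠ 0 := RatFunc.X_ne_zero
  simp only [qInt, zpow_add₀ hX, zpow_sub₀ hX, two_mul]
  have hk := zpow_ne_zero k hX
  generalize (RatFunc.X : RatFunc ℚ) ^ k = x at *
  generalize (RatFunc.X : RatFunc ℚ) ^ l = y
  generalize (RatFunc.X : RatFunc ℚ) ^ m = z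
  generalize (RatFunc.X : RatFunc ℚ) ^ n = w
  field_simp
  ring

theorem dixonTerm_telescope (l m n k : ℤ) :
    (1 + RatFunc.X ^ k) * (qInt n * qInt (m + n) * qInt (n + l) * dixonTerm l m n k -
        qInt (l + m + n) * dixonTerm l m (n - 1) k) =
      dixonMate l m n (k + 1) - dixonMate l m n k := by
  rw [dixonMate_succ, dixonMate, dixonTerm_sub_one]
  linear_combination dixonTerm l m n k * qInt_dixon_identity l m n k

theorem dixonTerm_eq_zero_left {l m n k : ℤ} (h : l < |k|) : dixonTerm l m n k = 0 := by
  rw [dixonTerm, qInvFactPair_eq_zero h]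
  ring

theorem sum_dixonMate_succ (l m n : ℤ) :
    ∑ k ∈ Icc (-l) l, dixonMate l m n (k + 1) = ∑ k ∈ Icc (-l) l, dixonMate l m n k := by
  have hshift : ∑ k ∈ Icc (-l) l, dixonMate l m n (k + 1) =
      ∑ k ∈ Icc (-l + 1) (l + 1), dixonMate l m n k := by
    rw [← map_add_right_Icc, sum_map]
    rfl
  rw [hshift]
  trans ∑ k ∈ Icc (-l + 1) l, dixonMate l m n k
  · symm
    refine sum_subset (Icc_subset_Icc le_rfl (by omega)) fun k hk hk' => ?_
    rw [mem_Icc] at hk hk'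
    rw [dixonMate, dixonTerm_eq_zero_left (lt_abs.mpr (by omega))]
    ring
  · refine sum_subset (Icc_subset_Icc (by omega) le_rfl) fun k hk hk' => ?_
    rw [mem_Icc] at hk hk'
    rw [dixonMate, show l + k = 0 by omega, qInt_zero]
    ring

theorem sum_symmetrized_dixonTerm (l m n : ℤ) :
    ∑ k ∈ Icc (-l) l, (1 + RatFunc.X ^ k) * dixonTerm l m n k =
      2 * ∑ k ∈ Icc (-l) l, dixonTerm l m n k := by
  have hneg : ∑ k ∈ Icc (-l) l, dixonTerm l m n (-k) = ∑ k ∈ Icc (-l) l, dixonTerm l m n k :=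
    sum_nbij' (fun k => -k) (fun k => -k) (by grind) (by grind) (by simp) (by simp) (by simp)
  rw [two_mul]
  nth_rw 2 [← hneg]
  rw [← sum_add_distrib]
  refine sum_congr rfl fun k _ => ?_
  rw [dixonTerm_neg]
  ring

theorem sum_dixonTerm_recurrence (l m n : ℤ) :
    qInt n * qInt (m + n) * qInt (n + l) * ∑ k ∈ Icc (-l) l, dixonTerm l m n k =
      qInt (l + m + n) * ∑ k ∈ Icc (-l) l, dixonTerm l m (n - 1) k := by
  have h := sum_congr (rfl : Icc (-l) l = _) fun k _ => dixonTerm_telescope l m n k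
  rw [sum_sub_distrib, sum_dixonMate_succ, sub_self] at h
  have h' : qInt n * qInt (m + n) * qInt (n + l) *
        ∑ k ∈ Icc (-l) l, (1 + RatFunc.X ^ k) * dixonTerm l m n k -
      qInt (l + m + n) * ∑ k ∈ Icc (-l) l, (1 + RatFunc.X ^ k) * dixonTerm l m (n - 1) k = 0 := by
    rw [← h, mul_sum, mul_sum, ← sum_sub_distrib]
    exact sum_congr rfl fun k _ => by ring
  rw [sum_symmetrized_dixonTerm, sum_symmetrized_dixonTerm] at h'
  linear_combination h' / 2

theorem sum_dixonTerm (l m n : ℕ) :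
    ∑ k ∈ Icc (-(l : ℤ)) l, dixonTerm l m n k =
      qFact (l + m + n) /
        (qFact l * qFact m * qFact n * qFact (l + m) * qFact (m + n) * qFact (n + l)) := by
  induction n with
  | zero =>
    rw [sum_eq_single 0]
    · have h₀ := qInvFact_natCast 0
      have hl := qFact_ne_zero l
      have hm := qFact_ne_zero m
      have hlm := qFact_ne_zero (l + m)
      simp only [Nat.cast_zero, qFact_zero] at h₀
      simp only [dixonTerm, pentagonalWeight, qInvFactPair, qInvFact_natCast, Nat.cast_zero,
        add_zero, sub_zero, zero_add, h₀, qFact_zero]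
      simp
      field_simp
    · intro k _ hk
      rw [dixonTerm, qInvFactPair_eq_zero (n := ((0 : ℕ) : ℤ)) (by simpa using hk), mul_zero]
    · simp
  | succ n ih =>
    have h := sum_dixonTerm_recurrence l m (n + 1 : ℕ)
    rw [show ((n + 1 : ℕ) : ℤ) - 1 = n by push_cast; ring, ih] at h
    simp only [← Nat.cast_add] at h
    rw [← add_assoc, ← add_assoc, show n + 1 + l = n + l + 1 by ring] at h ⊢
    rw [qFact_succ, qFact_succ, qFact_succ, qFact_succ]
    have h₁ := qInt_natCast_ne_zero n.succ_ne_zero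
    have h₂ := qInt_natCast_ne_zero (m + n).succ_ne_zero
    have h₃ := qInt_natCast_ne_zero (n + l).succ_ne_zero
    have hl := qFact_ne_zero l
    have hm := qFact_ne_zero m
    have hn := qFact_ne_zero n
    have hlm := qFact_ne_zero (l + m)
    have hmn := qFact_ne_zero (m + n)
    have hnl := qFact_ne_zero (n + l)
    simp only [Nat.succ_eq_add_one] at h₁ h₂ h₃
    field_simp at h ⊢
    linear_combination h

theorem q_dixon (l m n : ℕ) :
    qFact (l + m + n) * qFact (2 * l) * qFact (2 * m) * qFact (2 * n) /
      (qFact l * qFact m * qFact n * qFact (l + m) * qFact (m + n) * qFact (n + l)) =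
    ∑ k ∈ Finset.Icc (-(min l (min m n) : ℤ)) (min l (min m n) : ℤ),
      (-1 : RatFunc ℚ) ^ k * RatFunc.X ^ (k * (3 * k - 1) / 2) *
        qBinom (2 * l) (l + k).toNat * qBinom (2 * m) (m + k).toNat *
        qBinom (2 * n) (n + k).toNat := by
  have hsum : ∑ k ∈ Icc (-(min l (min m n) : ℤ)) (min l (min m n) : ℤ), dixonTerm l m n k =
      ∑ k ∈ Icc (-(l : ℤ)) l, dixonTerm l m n k := by
    refine sum_subset (Icc_subset_Icc (by omega) (by omega)) fun k _ hk => ?_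
    rw [mem_Icc, ← abs_le, le_min_iff, le_min_iff] at hk
    rw [dixonTerm]
    by_cases hl : |k| ≤ l
    · by_cases hm : |k| ≤ m
      · rw [qInvFactPair_eq_zero (n := n) (not_le.mp fun hn => hk ⟨hl, hm, hn⟩), mul_zero]
      · rw [qInvFactPair_eq_zero (n := m) (not_le.mp hm), mul_zero, zero_mul]
    · rw [qInvFactPair_eq_zero (n := l) (not_le.mp hl), mul_zero, zero_mul, zero_mul]
  trans qFact (2 * l) * qFact (2 * m) * qFact (2 * n) *
    ∑ k ∈ Icc (-(min l (min m n) : ℤ)) (min l (min m n) : ℤ), dixonTerm l m n k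
  · rw [hsum, sum_dixonTerm]
    ring
  · rw [mul_sum]
    refine sum_congr rfl fun k hk => ?_
    rw [mem_Icc] at hk
    rw [qBinom_two_mul l (by omega), qBinom_two_mul m (by omega), qBinom_two_mul n (by omega),
      dixonTerm, pentagonalWeight]
    ring
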